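/- arXiv:1702.06167 — 6 statements merged into one kernel-verified Lean document; each statement's English description precedes it below -/
import Mathlib

section
/- Suppose each message m of a distributed computation carries an integer timestamp m.t and each checkpoint C an integer timestamp C.t such that: (i) if m is sent by P_i in interval I_i^x then m.t ≥ C_i^x.t; (ii) if m is received by P_k in interval I_k^w and m' is sent by P_k in an interval I_k^{w'} with w' ≥ w, then m'.t ≥ m.t; (iii) if m is received by P_j strictly before checkpoint C_j^y then C_j^y.t > m.t; and (iv) for every process P_i, the sequence of checkpoint timestamps is nondecreasing: C_i^{x+1}.t ≥ C_i^x.t whenever C_i^{x+1} exists. Then the checkpoint timestamping is Z-consistent: C ⇝ C' implies C.t < C'.t. -/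
/-- A distributed computation: `n ≥ 1` processes, each executing a sequence of
events indexed by positive integers; a type of messages with send/receive
processes and event indices; and for each process a (finite or infinite,
encoded by the domain predicate `hasCkpt`) strictly increasing sequence of
checkpoint event indices, starting at the index of the process's first event.
Checkpoint events are neither send nor receive events. -/
structure DistComputation where
  /-- number of processes -/
  n : ℕ
  n_pos : 1 ≤ n
  /-- the messages of the computation -/
  Msg : Type
  /-- sending process of a message -/
  snd : Msg → Fin n
  /-- index of the send event of a message -/
  sendIdx : Msg → ℕ
  /-- receiving process of a message -/
  rcv : Msg → Fin n
  /-- index of the receive event of a message -/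
  recvIdx : Msg → ℕ
  /-- event indices are positive -/
  sendIdx_pos : ∀ m, 1 ≤ sendIdx m
  recvIdx_pos : ∀ m, 1 ≤ recvIdx m
  /-- `hasCkpt i x`: process `i` has an `x`-th checkpoint (`x` counted from 1) -/
  hasCkpt : Fin n → ℕ → Prop
  /-- `ckptIdx i x`: the event index of the `x`-th checkpoint `C_i^x` of process `i` -/
  ckptIdx : Fin n → ℕ → ℕ
  /-- every process has a first checkpoint -/
  hasCkpt_one : ∀ i, hasCkpt i 1
  /-- the checkpoints of a process form an initial segment -/
  hasCkpt_of_succ : ∀ i x, hasCkpt i (x + 1) → hasCkpt i x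
  /-- the sequence of checkpoint indices is strictly increasing -/
  ckptIdx_strictMono : ∀ i x y, hasCkpt i x → hasCkpt i y → x < y → ckptIdx i x < ckptIdx i y
  /-- the first checkpoint is the first event of the process -/
  ckptIdx_one : ∀ i, ckptIdx i 1 = 1
  /-- checkpoint events are not send events -/
  ckpt_ne_send : ∀ i x m, hasCkpt i x → snd m = i → sendIdx m ≠ ckptIdx i x
  /-- checkpoint events are not receive events -/
  ckpt_ne_recv : ∀ i x m, hasCkpt i x → rcv m = i → recvIdx m ≠ ckptIdx i x

/-- An event: a process together with an event index. -/
abbrev DistComputation.Event (D : DistComputation) := Fin D.n × ℕ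

/-- Causal precedence `e → e'`: the smallest transitive relation such that each
event precedes the next event of the same process and the send event of every
message precedes its receive event. -/
inductive DistComputation.Precedes (D : DistComputation) : D.Event → D.Event → Prop
  | step (i : Fin D.n) (x : ℕ) : DistComputation.Precedes D (i, x) (i, x + 1)
  | msg (m : D.Msg) :
      DistComputation.Precedes D (D.snd m, D.sendIdx m) (D.rcv m, D.recvIdx m)
  | trans {e e' e'' : D.Event} : DistComputation.Precedes D e e' →
      DistComputation.Precedes D e' e'' → DistComputation.Precedes D e e''

/-- The event of process `k` with index `e` lies in the checkpoint interval
`I_k^w`: at or after `C_k^w` and, if `C_k^{w+1}` exists, strictly before it. -/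
def DistComputation.InInterval (D : DistComputation) (k : Fin D.n) (w : ℕ) (e : ℕ) : Prop :=
  D.hasCkpt k w ∧ D.ckptIdx k w ≤ e ∧ (D.hasCkpt k (w + 1) → e < D.ckptIdx k (w + 1))

/-- `ms = [m_1, …, m_q]` is a zigzag path from checkpoint `C_i^x` to
checkpoint `C_j^y`. -/
def DistComputation.IsZigzagPath (D : DistComputation) (ms : List D.Msg)
    (i : Fin D.n) (x : ℕ) (j : Fin D.n) (y : ℕ) : Prop :=
  ms ≠ [] ∧ D.hasCkpt i x ∧ D.hasCkpt j y ∧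
  -- `m_1` is sent by `P_i` at or after `C_i^x`
  (∀ m₁ ∈ ms.head?, D.snd m₁ = i ∧ D.ckptIdx i x ≤ D.sendIdx m₁) ∧
  -- each `m_z` is received by the process sending `m_{z+1}`, and if `m_z` is
  -- received in interval `I_k^w` then `m_{z+1}` is sent in an interval
  -- `I_k^{w'}` with `w' ≥ w`
  (∀ z : ℕ, ∀ hz : z + 1 < ms.length,
    D.rcv (ms[z]'(Nat.lt_of_succ_lt hz)) = D.snd (ms[z + 1]'hz) ∧
    ∀ w : ℕ, D.InInterval (D.rcv (ms[z]'(Nat.lt_of_succ_lt hz))) w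
        (D.recvIdx (ms[z]'(Nat.lt_of_succ_lt hz))) →
      ∃ w' : ℕ, w ≤ w' ∧
        D.InInterval (D.rcv (ms[z]'(Nat.lt_of_succ_lt hz))) w'
          (D.sendIdx (ms[z + 1]'hz))) ∧
  -- `m_q` is received by `P_j` strictly before `C_j^y`
  (∀ mq ∈ ms.getLast?, D.rcv mq = j ∧ D.recvIdx mq < D.ckptIdx j y)

/-- `C_i^x ⇝ C_j^y`: there is a zigzag path from `C_i^x` to `C_j^y`. -/
def DistComputation.ZigzagTo (D : DistComputation)
    (i : Fin D.n) (x : ℕ) (j : Fin D.n) (y : ℕ) : Prop :=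
  ∃ ms : List D.Msg, D.IsZigzagPath ms i x j y

/-- A zigzag path is causal if the send event of each `m_{z+1}` has index at
least the index of the receive event of `m_z` in their common process. -/
def DistComputation.IsCausal (D : DistComputation) (ms : List D.Msg) : Prop :=
  ∀ z : ℕ, ∀ hz : z + 1 < ms.length,
    D.recvIdx (ms[z]'(Nat.lt_of_succ_lt hz)) ≤ D.sendIdx (ms[z + 1]'hz)

/-- A logical-clock assignment on a distributed computation: an integer clock
`lc` on events, nondecreasing along each process, strictly increasing at each
checkpoint event having a predecessor; message timestamps equal to the clock
of the send event; and the clock at a receive event at least the message's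
timestamp. -/
structure LogicalClock (D : DistComputation) where
  /-- the logical clock of each event -/
  lc : D.Event → ℤ
  /-- the timestamp `m.t` of each message -/
  mt : D.Msg → ℤ
  /-- the clock is nondecreasing along each process's event sequence -/
  lc_mono : ∀ (i : Fin D.n) (x y : ℕ), x ≤ y → lc (i, x) ≤ lc (i, y)
  /-- the clock strictly increases at a checkpoint event that has an
  immediately preceding event of the same process -/
  lc_ckpt : ∀ (i : Fin D.n) (x : ℕ), D.hasCkpt i x → 2 ≤ D.ckptIdx i x →
      lc (i, D.ckptIdx i x - 1) < lc (i, D.ckptIdx i x)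
  /-- `m.t` is the clock of the send event of `m` -/
  mt_send : ∀ m, mt m = lc (D.snd m, D.sendIdx m)
  /-- the clock at the receive event of `m` is at least `m.t` -/
  mt_recv : ∀ m, mt m ≤ lc (D.rcv m, D.recvIdx m)

/-- The timestamp `C_i^x.t` of checkpoint `C_i^x` under a logical-clock
assignment: the clock of the checkpoint event. -/
def LogicalClock.ckptT {D : DistComputation} (L : LogicalClock D)
    (i : Fin D.n) (x : ℕ) : ℤ :=
  L.lc (i, D.ckptIdx i x)

/-- An event at or after an existing checkpoint lies in the interval of that
checkpoint or of a later one. -/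
theorem DistComputation.exists_inInterval (D : DistComputation) (i : Fin D.n) (x e : ℕ)
    (hx : D.hasCkpt i x) (hle : D.ckptIdx i x ≤ e) :
    ∃ w, x ≤ w ∧ D.InInterval i w e := by
  by_cases h : D.hasCkpt i (x + 1) ∧ D.ckptIdx i (x + 1) ≤ e
  · have hlt := D.ckptIdx_strictMono i x (x + 1) hx h.1 (Nat.lt_succ_self x)
    obtain ⟨w, hw, hin⟩ := D.exists_inInterval i (x + 1) e h.1 h.2
    exact ⟨w, by omega, hin⟩
  · exact ⟨x, le_rfl, hx, hle, fun h' => not_le.mp fun h'' => h ⟨h', h''⟩⟩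
termination_by e - D.ckptIdx i x

/-- Every receive event lies in some checkpoint interval. -/
theorem DistComputation.exists_inInterval_recvIdx (D : DistComputation) (m : D.Msg) :
    ∃ w, D.InInterval (D.rcv m) w (D.recvIdx m) := by
  obtain ⟨w, -, hw⟩ := D.exists_inInterval (D.rcv m) 1 (D.recvIdx m) (D.hasCkpt_one _)
    ((D.ckptIdx_one _).trans_le (D.recvIdx_pos m))
  exact ⟨w, hw⟩

/-- Checkpoint timestamps that are nondecreasing at each step are monotone on
the existing checkpoints. -/
theorem DistComputation.timestamp_mono (D : DistComputation) {ct : Fin D.n → ℕ → ℤ}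
    (h : ∀ (i : Fin D.n) (x : ℕ), D.hasCkpt i (x + 1) → ct i x ≤ ct i (x + 1))
    (i : Fin D.n) {x w : ℕ} (hxw : x ≤ w) (hw : D.hasCkpt i w) : ct i x ≤ ct i w := by
  induction w, hxw using Nat.le_induction with
  | base => exact le_rfl
  | succ w _ ih => exact (ih (D.hasCkpt_of_succ i w hw)).trans (h i w hw)

/-- If message and checkpoint timestamps satisfy (i)–(iv),
then the checkpoint timestamping is Z-consistent. -/
theorem timestamps_zconsistent (D : DistComputation)
    (mt : D.Msg → ℤ) (ct : Fin D.n → ℕ → ℤ)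
    -- (i) if `m` is sent by `P_i` in interval `I_i^x` then `m.t ≥ C_i^x.t`
    (h1 : ∀ (m : D.Msg) (x : ℕ),
      D.InInterval (D.snd m) x (D.sendIdx m) → ct (D.snd m) x ≤ mt m)
    -- (ii) if `m` is received by `P_k` in interval `I_k^w` and `m'` is sent by
    -- `P_k` in an interval `I_k^{w'}` with `w' ≥ w`, then `m'.t ≥ m.t`
    (h2 : ∀ (m m' : D.Msg) (w w' : ℕ), D.rcv m = D.snd m' →
      D.InInterval (D.rcv m) w (D.recvIdx m) →
      D.InInterval (D.rcv m) w' (D.sendIdx m') → w ≤ w' → mt m ≤ mt m')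
    -- (iii) if `m` is received by `P_j` strictly before `C_j^y` then
    -- `C_j^y.t > m.t`
    (h3 : ∀ (m : D.Msg) (y : ℕ), D.hasCkpt (D.rcv m) y →
      D.recvIdx m < D.ckptIdx (D.rcv m) y → mt m < ct (D.rcv m) y)
    -- (iv) checkpoint timestamps are nondecreasing along each process
    (h4 : ∀ (i : Fin D.n) (x : ℕ), D.hasCkpt i (x + 1) → ct i x ≤ ct i (x + 1)) :
    ∀ (i : Fin D.n) (x : ℕ) (j : Fin D.n) (y : ℕ),
      D.ZigzagTo i x j y → ct i x < ct j y := by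
  rintro i x j y ⟨ms, hne, hx, hy, hhead, hstep, hlast⟩
  have hpos : 0 < ms.length := List.length_pos_iff.mpr hne
  have hchain : ∀ z : ℕ, ∀ hz : z < ms.length, mt ms[0] ≤ mt ms[z] := by
    intro z
    induction z with
    | zero => exact fun _ => le_rfl
    | succ z ih =>
      intro hz
      obtain ⟨heq, hint⟩ := hstep z hz
      obtain ⟨w, hw⟩ := D.exists_inInterval_recvIdx ms[z]
      obtain ⟨w', hww', hw'⟩ := hint w hw
      exact (ih (by omega)).trans (h2 _ _ w w' heq hw hw' hww')
  obtain ⟨rfl, hsend⟩ := hhead ms[0] (by simp [List.head?_eq_getElem?])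
  obtain ⟨rfl, hrecv⟩ := hlast (ms[ms.length - 1]) (by simp [List.getLast?_eq_getElem?])
  obtain ⟨w, hxw, hw⟩ := D.exists_inInterval _ x _ hx hsend
  calc ct (D.snd ms[0]) x ≤ ct (D.snd ms[0]) w := D.timestamp_mono h4 _ hxw hw.1
    _ ≤ mt ms[0] := h1 _ w hw
    _ ≤ mt ms[ms.length - 1] := hchain _ _
    _ < ct (D.rcv ms[ms.length - 1]) y := h3 _ y hy hrecv
end

section
/- If checkpoint C_i^x causally precedes checkpoint C_j^y and i ≠ j, then there is a zigzag path from C_i^x to C_j^y; moreover, this zigzag path can be chosen causal. In particular, C_i^x → C_j^y with i ≠ j implies C_i^x ⇝ C_j^y. -/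
namespace DistComputation

/-- `ms` is a nonempty causal chain of messages leaving `e` and arriving at `e'`. -/
def IsCausalChain (D : DistComputation) (ms : List D.Msg) (e e' : D.Event) : Prop :=
  ms ≠ [] ∧ (∀ m ∈ ms.head?, D.snd m = e.1 ∧ e.2 ≤ D.sendIdx m) ∧
  ms.IsChain (fun m m' => D.rcv m = D.snd m' ∧ D.recvIdx m ≤ D.sendIdx m') ∧
  (∀ m ∈ ms.getLast?, D.rcv m = e'.1 ∧ D.recvIdx m ≤ e'.2)

variable {D : DistComputation}

theorem IsCausalChain.mono {ms : List D.Msg} {a e e' b : D.Event}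
    (h : D.IsCausalChain ms e e') (ha : a.1 = e.1) (ha' : a.2 ≤ e.2)
    (hb : e'.1 = b.1) (hb' : e'.2 ≤ b.2) : D.IsCausalChain ms a b := by
  obtain ⟨h₁, h₂, h₃, h₄⟩ := h
  exact ⟨h₁, fun m hm => ⟨(h₂ m hm).1.trans ha.symm, ha'.trans (h₂ m hm).2⟩, h₃,
    fun m hm => ⟨(h₄ m hm).1.trans hb, (h₄ m hm).2.trans hb'⟩⟩

theorem IsCausalChain.append {ms ms' : List D.Msg} {a b c : D.Event}
    (h : D.IsCausalChain ms a b) (h' : D.IsCausalChain ms' b c) :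
    D.IsCausalChain (ms ++ ms') a c := by
  obtain ⟨h₁, h₂, h₃, h₄⟩ := h
  obtain ⟨h₁', h₂', h₃', h₄'⟩ := h'
  refine ⟨by simp [h₁], ?_, ?_, ?_⟩
  · rwa [List.head?_append_of_ne_nil _ h₁]
  · refine List.isChain_append.2 ⟨h₃, h₃', fun m hm m' hm' => ?_⟩
    exact ⟨(h₄ m hm).1.trans (h₂' m' hm').1.symm, (h₄ m hm).2.trans (h₂' m' hm').2⟩
  · rwa [List.getLast?_append_of_ne_nil _ h₁']

theorem Precedes.same_process_or_exists_isCausalChain {e e' : D.Event} (h : D.Precedes e e') :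
    (e.1 = e'.1 ∧ e.2 ≤ e'.2) ∨ ∃ ms, D.IsCausalChain ms e e' := by
  induction h with
  | step i x => exact .inl ⟨rfl, Nat.le_succ x⟩
  | msg m => exact .inr ⟨[m], by simp [IsCausalChain]⟩
  | trans _ _ ih ih' =>
    rcases ih with ⟨h₁, h₂⟩ | ⟨ms, hms⟩ <;> rcases ih' with ⟨h₁', h₂'⟩ | ⟨ms', hms'⟩
    · exact .inl ⟨h₁.trans h₁', h₂.trans h₂'⟩
    · exact .inr ⟨ms', hms'.mono h₁ h₂ rfl le_rfl⟩
    · exact .inr ⟨ms, hms.mono rfl le_rfl h₁' h₂'⟩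
    · exact .inr ⟨ms ++ ms', hms.append hms'⟩

theorem exists_inInterval_of_ckptIdx_le {k : Fin D.n} {w e : ℕ} (hw : D.hasCkpt k w)
    (he : D.ckptIdx k w ≤ e) : ∃ w', w ≤ w' ∧ D.InInterval k w' e := by
  by_cases h : D.hasCkpt k (w + 1) ∧ D.ckptIdx k (w + 1) ≤ e
  · have hlt := D.ckptIdx_strictMono k w (w + 1) hw h.1 w.lt_succ_self
    obtain ⟨w', hw', hI⟩ := exists_inInterval_of_ckptIdx_le h.1 h.2
    exact ⟨w', by omega, hI⟩
  · exact ⟨w, le_rfl, hw, he, fun h' => not_le.1 fun hle => h ⟨h', hle⟩⟩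
termination_by e - D.ckptIdx k w

end DistComputation

/-- If checkpoint `C_i^x` causally precedes checkpoint `C_j^y`
and `i ≠ j`, then there is a zigzag path from `C_i^x` to `C_j^y`, which can
moreover be chosen causal; in particular `C_i^x ⇝ C_j^y`. -/
theorem zigzag_of_precedes (D : DistComputation)
    (i : Fin D.n) (x : ℕ) (j : Fin D.n) (y : ℕ)
    (hx : D.hasCkpt i x) (hy : D.hasCkpt j y) (hij : i ≠ j)
    (h : D.Precedes (i, D.ckptIdx i x) (j, D.ckptIdx j y)) :
    (∃ ms : List D.Msg, D.IsZigzagPath ms i x j y ∧ D.IsCausal ms) ∧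
      D.ZigzagTo i x j y := by
  obtain ⟨h₁, -⟩ | ⟨ms, hne, hhead, hchain, hlast⟩ := h.same_process_or_exists_isCausalChain
  · exact absurd h₁ hij
  rw [List.isChain_iff_getElem] at hchain
  have hpath : D.IsZigzagPath ms i x j y := by
    refine ⟨hne, hx, hy, hhead, fun z hz => ⟨(hchain z hz).1, fun w hw => ?_⟩, fun m hm => ?_⟩
    · exact DistComputation.exists_inInterval_of_ckptIdx_le hw.1
        (hw.2.1.trans (hchain z hz).2)
    · obtain ⟨hr, hle⟩ := hlast m hm
      exact ⟨hr, lt_of_le_of_ne hle (D.ckpt_ne_recv j y m hy hr)⟩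
  exact ⟨⟨ms, hpath, fun z hz => (hchain z hz).2⟩, ms, hpath⟩
end

section
/- Let G be a global checkpoint of a distributed computation (a set containing exactly one checkpoint of each of the n processes). If there is no zigzag path between any two distinct members of G, then G is consistent: no member of G causally precedes another member. -/
/-- If the `w`-th checkpoint of process `k` is at or before the event `e`, then `e` lies in
a checkpoint interval of index at least `w`. -/
theorem DistComputation.exists_inInterval_of_le (D : DistComputation) {k : Fin D.n} {w e : ℕ}
    (hw : D.hasCkpt k w) (hle : D.ckptIdx k w ≤ e) :
    ∃ w', w ≤ w' ∧ D.InInterval k w' e := by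
  by_contra! hcon
  have hall : ∀ d, D.hasCkpt k (w + d) ∧ D.ckptIdx k (w + d) ≤ e ∧ d ≤ D.ckptIdx k (w + d) := by
    intro d
    induction d with
    | zero => exact ⟨hw, hle, Nat.zero_le _⟩
    | succ d ih =>
      obtain ⟨hc, hd, hdd⟩ := ih
      have hnot := hcon (w + d) (Nat.le_add_right w d)
      have hsucc : D.hasCkpt k (w + d + 1) ∧ D.ckptIdx k (w + d + 1) ≤ e := by
        by_contra hneg
        exact hnot ⟨hc, hd, fun h => not_le.mp fun hl => hneg ⟨h, hl⟩⟩
      have hlt := D.ckptIdx_strictMono k (w + d) (w + d + 1) hc hsucc.1 (Nat.lt_succ_self _)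
      exact ⟨hsucc.1, hsucc.2, Nat.succ_le_of_lt (hdd.trans_lt hlt)⟩
  have := hall (e + 1)
  omega

/-- `ms` is a nonempty causal message chain, sent from the first event or later on the same
process, and received at the second event or earlier on the same process. -/
def DistComputation.IsMessageChain (D : DistComputation) (ms : List D.Msg)
    (e e' : D.Event) : Prop :=
  ms ≠ [] ∧ (∀ m ∈ ms.head?, D.snd m = e.1 ∧ e.2 ≤ D.sendIdx m) ∧
    ms.IsChain (fun m m' => D.rcv m = D.snd m' ∧ D.recvIdx m ≤ D.sendIdx m') ∧
    (∀ m ∈ ms.getLast?, D.rcv m = e'.1 ∧ D.recvIdx m ≤ e'.2)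

/-- Causal precedence is either local order on one process or witnessed by a causal
message chain. -/
theorem DistComputation.Precedes.lt_or_exists_isMessageChain {D : DistComputation}
    {e e' : D.Event} (h : D.Precedes e e') :
    (e.1 = e'.1 ∧ e.2 < e'.2) ∨ ∃ ms, D.IsMessageChain ms e e' := by
  induction h with
  | step i x => exact Or.inl ⟨rfl, Nat.lt_succ_self x⟩
  | msg m => exact Or.inr ⟨[m], by simp [DistComputation.IsMessageChain]⟩
  | trans _ _ ih₁ ih₂ =>
    rcases ih₁ with ⟨hp, hlt⟩ | ⟨ms, hne, hhead, hchain, hlast⟩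
    · rcases ih₂ with ⟨hp', hlt'⟩ | ⟨ms', hne', hhead', hchain', hlast'⟩
      · exact Or.inl ⟨hp.trans hp', hlt.trans hlt'⟩
      · refine Or.inr ⟨ms', hne', fun m hm => ?_, hchain', hlast'⟩
        obtain ⟨h₁, h₂⟩ := hhead' m hm
        exact ⟨h₁.trans hp.symm, hlt.le.trans h₂⟩
    · rcases ih₂ with ⟨hp', hlt'⟩ | ⟨ms', hne', hhead', hchain', hlast'⟩
      · refine Or.inr ⟨ms, hne, hhead, hchain, fun m hm => ?_⟩
        obtain ⟨h₁, h₂⟩ := hlast m hm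
        exact ⟨h₁.trans hp', h₂.trans hlt'.le⟩
      · refine Or.inr ⟨ms ++ ms', by simp [hne], ?_, ?_, ?_⟩
        · rwa [List.head?_append_of_ne_nil _ hne]
        · refine List.isChain_append.mpr ⟨hchain, hchain', fun m hm m' hm' => ?_⟩
          obtain ⟨h₁, h₂⟩ := hlast m hm
          obtain ⟨h₃, h₄⟩ := hhead' m' hm'
          exact ⟨h₁.trans h₃.symm, h₂.trans h₄⟩
        · rwa [List.getLast?_append_of_ne_nil _ hne']

/-- A causal message chain between two checkpoints is a zigzag path. -/
theorem DistComputation.IsMessageChain.isZigzagPath {D : DistComputation} {ms : List D.Msg}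
    {i j : Fin D.n} {x y : ℕ} (hx : D.hasCkpt i x) (hy : D.hasCkpt j y)
    (h : D.IsMessageChain ms (i, D.ckptIdx i x) (j, D.ckptIdx j y)) :
    D.IsZigzagPath ms i x j y := by
  obtain ⟨hne, hhead, hchain, hlast⟩ := h
  refine ⟨hne, hx, hy, hhead, fun z hz => ?_, fun m hm => ?_⟩
  · obtain ⟨hp, hle⟩ := List.isChain_iff_getElem.mp hchain z hz
    exact ⟨hp, fun w hw => D.exists_inInterval_of_le hw.1 (hw.2.1.trans hle)⟩
  · obtain ⟨hp, hle⟩ := hlast m hm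
    exact ⟨hp, lt_of_le_of_ne hle (D.ckpt_ne_recv j y m hy hp)⟩

/-- A global checkpoint (one checkpoint `C_i^{g i}` per process)
with no zigzag path between any two distinct members is consistent: no member
causally precedes another member. -/
theorem consistent_of_no_zigzag (D : DistComputation)
    (g : Fin D.n → ℕ) (hg : ∀ i, D.hasCkpt i (g i))
    (hnozz : ∀ i j : Fin D.n, i ≠ j → ¬ D.ZigzagTo i (g i) j (g j)) :
    ∀ i j : Fin D.n, i ≠ j →
      ¬ D.Precedes (i, D.ckptIdx i (g i)) (j, D.ckptIdx j (g j)) := by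
  intro i j hij hprec
  rcases hprec.lt_or_exists_isMessageChain with ⟨hp, _⟩ | ⟨ms, hms⟩
  · exact hij hp
  · exact hnozz i j hij ⟨ms, hms.isZigzagPath (hg i) (hg j)⟩
end

section
/- Assume causal precedence of the distributed computation is irreflexive (no event causally precedes itself). Then no causal zigzag path is a Z-cycle: there is no causal zigzag path from a checkpoint to itself. -/
theorem DistComputation.precedes_of_lt (D : DistComputation) (i : Fin D.n) {a b : ℕ}
    (hab : a < b) : D.Precedes (i, a) (i, b) := by
  induction b, hab using Nat.le_induction with
  | base => exact .step i a
  | succ b _ ih => exact ih.trans (.step i b)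

/-- Along a causal chain of messages, the first send event precedes every receive event. -/
theorem DistComputation.IsCausal.send_precedes_recv {D : DistComputation} {ms : List D.Msg}
    (hc : D.IsCausal ms)
    (hproc : ∀ z : ℕ, ∀ hz : z + 1 < ms.length,
      D.rcv (ms[z]'(Nat.lt_of_succ_lt hz)) = D.snd (ms[z + 1]'hz))
    (z : ℕ) (hz : z < ms.length) :
    D.Precedes (D.snd (ms[0]'(Nat.zero_lt_of_lt hz)), D.sendIdx (ms[0]'(Nat.zero_lt_of_lt hz)))
      (D.rcv ms[z], D.recvIdx ms[z]) := by
  induction z with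
  | zero => exact .msg _
  | succ z ih =>
    have hprev := ih (Nat.lt_of_succ_lt hz)
    rw [hproc z hz] at hprev
    rcases (hc z hz).lt_or_eq with hlt | heq
    · exact (hprev.trans (D.precedes_of_lt _ hlt)).trans (.msg _)
    · rw [heq] at hprev
      exact hprev.trans (.msg _)

/-- If causal precedence is irreflexive, then no causal zigzag
path is a Z-cycle: there is no causal zigzag path from a checkpoint to itself. -/
theorem no_causal_zcycle (D : DistComputation)
    (hirr : ∀ e : D.Event, ¬ D.Precedes e e) :
    ∀ (ms : List D.Msg) (i : Fin D.n) (x : ℕ),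
      D.IsCausal ms → ¬ D.IsZigzagPath ms i x i x := by
  rintro ms i x hc ⟨hne, -, -, hfirst, hstep, hlast⟩
  have hpos : 0 < ms.length := List.length_pos_of_ne_nil hne
  obtain ⟨hsnd, hsend⟩ := hfirst ms[0] (by simp [List.head?_eq_getElem?])
  obtain ⟨hrcv, hrecv⟩ := hlast (ms[ms.length - 1]) (by simp [List.getLast?_eq_getElem?])
  have hpath := hc.send_precedes_recv (fun z hz => (hstep z hz).1) (ms.length - 1) (by omega)
  rw [hsnd, hrcv] at hpath
  exact hirr _ (hpath.trans (D.precedes_of_lt i (hrecv.trans_le hsend)))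
end

section
/- Assume causal precedence of the distributed computation is irreflexive (no event causally precedes itself). If a checkpoint C lies on a Z-cycle, then C belongs to no consistent global checkpoint: every global checkpoint containing C has two members (not necessarily distinct from C) one of which causally precedes the other. -/
namespace DistComputation

theorem precedes_of_lt_s11 (D : DistComputation) (i : Fin D.n) {a b : ℕ} (h : a < b) :
    D.Precedes (i, a) (i, b) := by
  induction b, h using Nat.le_induction with
  | base => exact .step i a
  | succ b _ ih => exact .trans ih (.step i b)

/-- A message sent at or after an event of its sender and received strictly before an event of
its receiver makes the former event causally precede the latter. -/
theorem precedes_of_msg (D : DistComputation) (m : D.Msg) {a b : ℕ}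
    (ha : a ≤ D.sendIdx m) (hb : D.recvIdx m < b) :
    D.Precedes (D.snd m, a) (D.rcv m, b) := by
  have h : D.Precedes (D.snd m, D.sendIdx m) (D.rcv m, b) :=
    .trans (.msg m) (D.precedes_of_lt_s11 _ hb)
  rcases ha.eq_or_lt with rfl | ha
  · exact h
  · exact .trans (D.precedes_of_lt_s11 _ ha) h

theorem ckptIdx_mono (D : DistComputation) {k : Fin D.n} {x y : ℕ} (hx : D.hasCkpt k x)
    (hy : D.hasCkpt k y) (hxy : x ≤ y) : D.ckptIdx k x ≤ D.ckptIdx k y := by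
  rcases hxy.eq_or_lt with rfl | h
  · exact le_rfl
  · exact (D.ckptIdx_strictMono k x y hx hy h).le

theorem le_ckptIdx (D : DistComputation) {k : Fin D.n} {x : ℕ} (hx : D.hasCkpt k x) :
    x ≤ D.ckptIdx k x := by
  induction x with
  | zero => exact Nat.zero_le _
  | succ x ih =>
    have hx' := D.hasCkpt_of_succ k x hx
    exact (ih hx').trans_lt (D.ckptIdx_strictMono k x (x + 1) hx' hx x.lt_succ_self)

/-- Every event at or after a checkpoint lies in the interval of that checkpoint or of a later
one. -/
theorem exists_inInterval_s11 (D : DistComputation) {k : Fin D.n} {x e : ℕ} (hx : D.hasCkpt k x)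
    (he : D.ckptIdx k x ≤ e) : ∃ w, x ≤ w ∧ D.InInterval k w e := by
  classical
  let p : ℕ → Prop := fun w => D.hasCkpt k w ∧ D.ckptIdx k w ≤ e
  have hxe : x ≤ e := (D.le_ckptIdx hx).trans he
  have hp : p (Nat.findGreatest p e) := Nat.findGreatest_spec hxe ⟨hx, he⟩
  refine ⟨Nat.findGreatest p e, Nat.le_findGreatest hxe ⟨hx, he⟩, hp.1, hp.2, fun hs => ?_⟩
  by_contra! h
  exact absurd (Nat.le_findGreatest (P := p) ((D.le_ckptIdx hs).trans h) ⟨hs, h⟩)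
    (Nat.not_succ_le_self _)

end DistComputation

/-- If causal precedence is irreflexive and a checkpoint
`C_j^y` lies on a Z-cycle, then `C_j^y` belongs to no consistent global
checkpoint: every global checkpoint containing it has two members, one of
which causally precedes the other. -/
theorem zcycle_in_no_consistent_global_ckpt (D : DistComputation)
    (hirr : ∀ e : D.Event, ¬ D.Precedes e e)
    (j : Fin D.n) (y : ℕ) (hy : D.hasCkpt j y) (hcycle : D.ZigzagTo j y j y) :
    ∀ g : Fin D.n → ℕ, (∀ i, D.hasCkpt i (g i)) → g j = y →
      ∃ i k : Fin D.n, i ≠ k ∧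
        D.Precedes (i, D.ckptIdx i (g i)) (k, D.ckptIdx k (g k)) := by
  rintro g hg rfl
  by_contra! hcon
  have hmsg : ∀ m, D.ckptIdx (D.snd m) (g (D.snd m)) ≤ D.sendIdx m →
      D.ckptIdx (D.rcv m) (g (D.rcv m)) ≤ D.recvIdx m := by
    intro m hm
    by_contra! h
    have hprec := D.precedes_of_msg m hm h
    by_cases heq : D.snd m = D.rcv m
    · rw [heq] at hprec
      exact hirr _ hprec
    · exact hcon _ _ heq hprec
  obtain ⟨ms, hne, -, -, hhead, hstep, hlast⟩ := hcycle
  have hsend : ∀ z (hz : z < ms.length),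
      D.ckptIdx (D.snd ms[z]) (g (D.snd ms[z])) ≤ D.sendIdx ms[z] := by
    intro z
    induction z with
    | zero =>
      intro hz
      obtain ⟨hs, hle⟩ := hhead ms[0] (by simp [List.head?_eq_getElem?, hz])
      rwa [hs]
    | succ z ih =>
      intro hz
      obtain ⟨hproc, hint⟩ := hstep z hz
      obtain ⟨w, hgw, hw⟩ := D.exists_inInterval_s11 (hg _) (hmsg _ (ih (Nat.lt_of_succ_lt hz)))
      obtain ⟨w', hww', hw', hle, -⟩ := hint w hw
      rw [← hproc]
      exact (D.ckptIdx_mono (hg _) hw' (hgw.trans hww')).trans hle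
  obtain ⟨hr, hlt⟩ := hlast (ms.getLast hne) (List.getLast?_eq_some_getLast hne)
  have hpos := List.length_pos_iff.mpr hne
  have h := hmsg _ (hsend (ms.length - 1) (by omega))
  rw [← List.getLast_eq_getElem hne, hr] at h
  exact absurd hlt h.not_gt
end

section
/- Given a logical-clock assignment on a distributed computation, any global checkpoint all of whose members have the same timestamp is consistent: if G contains exactly one checkpoint of each process and all checkpoints in G have equal timestamps C.t, then no member of G causally precedes another member. -/
/-- A logical clock is monotone along causal precedence. -/
theorem LogicalClock.lc_le_of_precedes {D : DistComputation} (L : LogicalClock D)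
    {e e' : D.Event} (h : D.Precedes e e') : L.lc e ≤ L.lc e' := by
  induction h with
  | step i x => exact L.lc_mono i x (x + 1) x.le_succ
  | msg m => exact (L.mt_send m).symm.le.trans (L.mt_recv m)
  | trans _ _ ih₁ ih₂ => exact ih₁.trans ih₂

/-- If `e → e'`, then either `e` comes no later than `e'` on the same process, or the process of
`e'` has received a message by `e'` at which the clock is already at least that of `e`. -/
theorem LogicalClock.local_or_exists_recv_of_precedes {D : DistComputation} (L : LogicalClock D)
    {e e' : D.Event} (h : D.Precedes e e') :
    (e.1 = e'.1 ∧ e.2 ≤ e'.2) ∨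
      ∃ m, D.rcv m = e'.1 ∧ D.recvIdx m ≤ e'.2 ∧ L.lc e ≤ L.lc (D.rcv m, D.recvIdx m) := by
  induction h with
  | step i x => exact .inl ⟨rfl, x.le_succ⟩
  | msg m => exact .inr ⟨m, rfl, le_rfl, L.lc_le_of_precedes (.msg m)⟩
  | trans h₁ _ ih₁ ih₂ =>
    rcases ih₂ with ⟨hp, hle⟩ | ⟨m, hm, hle, hlc⟩
    · rcases ih₁ with ⟨hp', hle'⟩ | ⟨m, hm, hle', hlc⟩
      · exact .inl ⟨hp'.trans hp, hle'.trans hle⟩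
      · exact .inr ⟨m, hm.trans hp, hle'.trans hle, hlc⟩
    · exact .inr ⟨m, hm, hle, (L.lc_le_of_precedes h₁).trans hlc⟩

/-- The clock at a checkpoint exceeds the clock at every causally preceding event of another
process. -/
theorem LogicalClock.lc_lt_ckptT_of_precedes {D : DistComputation} (L : LogicalClock D)
    {e : D.Event} {j : Fin D.n} {y : ℕ} (hy : D.hasCkpt j y) (hne : e.1 ≠ j)
    (h : D.Precedes e (j, D.ckptIdx j y)) : L.lc e < L.ckptT j y := by
  rcases L.local_or_exists_recv_of_precedes h with ⟨hp, -⟩ | ⟨m, rfl, hle, hlc⟩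
  · exact absurd hp hne
  · have hlt : D.recvIdx m < D.ckptIdx (D.rcv m) y :=
      lt_of_le_of_ne hle (D.ckpt_ne_recv _ y m hy rfl)
    have hpos := D.recvIdx_pos m
    calc L.lc e ≤ L.lc (D.rcv m, D.recvIdx m) := hlc
      _ ≤ L.lc (D.rcv m, D.ckptIdx (D.rcv m) y - 1) := L.lc_mono _ _ _ (by omega)
      _ < L.ckptT (D.rcv m) y := L.lc_ckpt _ y hy (by omega)

/-- Under a logical-clock assignment, a global checkpoint all of
whose members have the same timestamp is consistent: no member causally
precedes another member. -/
theorem same_timestamp_consistent (D : DistComputation) (L : LogicalClock D)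
    (g : Fin D.n → ℕ) (hg : ∀ i, D.hasCkpt i (g i))
    (heq : ∀ i j : Fin D.n, L.ckptT i (g i) = L.ckptT j (g j)) :
    ∀ i j : Fin D.n, i ≠ j →
      ¬ D.Precedes (i, D.ckptIdx i (g i)) (j, D.ckptIdx j (g j)) := by
  intro i j hij h
  exact (L.lc_lt_ckptT_of_precedes (hg j) hij h).ne (heq i j)
end
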